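/- Let K ≥ 1 and let p be a strictly positive probability mass function on Bool^K, the joint law of binary variables R₁, …, R_K (value 1 = true). For r ∈ Bool^K write r_{≺k} = (r₁, …, r_{k−1}), and let 'R_{−k} = 1' denote the event that all coordinates other than k equal 1, 'R_{≻k} = 1' the event that all coordinates after k equal 1. For 2 ≤ k ≤ K define the odds-ratio factor OR_k(r) = [p(R_k = r_k | R_{≻k} = 1, R_{≺k} = r_{≺k}) / p(R_k = 1 | R_{≻k} = 1, R_{≺k} = r_{≺k})] · [p(R_k = 1 | R_{−k} = 1) / p(R_k = r_k | R_{−k} = 1)], and define the normalizer σ = Σ_{r ∈ Bool^K} [ ∏_{k=1}^{K} p(R_k = r_k | R_{−k} = 1) · ∏_{k=2}^{K} OR_k(r) ]. Then σ > 0 and for every r ∈ Bool^K: p(r) = (1/σ) · ∏_{k=1}^{K} p(R_k = r_k | R_{−k} = 1) · ∏_{k=2}^{K} OR_k(r). (This is the odds-ratio parameterization of the missingness mechanism used as the identifying functional in Theorems 1, 2 and 4.) -/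

import Mathlib

open scoped BigOperators

/-- Probability of the event `A` under the (finitely supported) law `p`. -/
noncomputable def Pr {Ω : Type*} [Fintype Ω] (p : Ω → ℝ) (A : Set Ω) : ℝ :=
  ∑ ω, A.indicator p ω

/-- Conditional probability `p(A | B) = p(A ∩ B) / p(B)`. -/
noncomputable def cPr {Ω : Type*} [Fintype Ω] (p : Ω → ℝ) (A B : Set Ω) : ℝ :=
  Pr p (A ∩ B) / Pr p B

/-- The event `R_{−k} = 1`: all coordinates other than `k` equal `1` (= `true`). -/
def minusOne {K : ℕ} (k : Fin K) : Set (Fin K → Bool) :=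
  {s | ∀ j, j ≠ k → s j = true}

/-- The event `R_{≻k} = 1, R_{≺k} = r_{≺k}`: all coordinates after `k` equal `1`
and all coordinates before `k` agree with `r`. -/
def succOnePrecR {K : ℕ} (k : Fin K) (r : Fin K → Bool) : Set (Fin K → Bool) :=
  {s | (∀ j, k < j → s j = true) ∧ (∀ j, j < k → s j = r j)}

/-- The odds-ratio factor
`OR_k(r) = [p(R_k = r_k | R_{≻k}=1, R_{≺k}=r_{≺k}) / p(R_k = 1 | R_{≻k}=1, R_{≺k}=r_{≺k})]
  · [p(R_k = 1 | R_{−k}=1) / p(R_k = r_k | R_{−k}=1)]`. -/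
noncomputable def ORfactor {K : ℕ} (p : (Fin K → Bool) → ℝ) (k : Fin K)
    (r : Fin K → Bool) : ℝ :=
  (cPr p {s | s k = r k} (succOnePrecR k r) / cPr p {s | s k = true} (succOnePrecR k r))
    * (cPr p {s | s k = true} (minusOne k) / cPr p {s | s k = r k} (minusOne k))

theorem Pr_singleton {Ω : Type*} [Fintype Ω] (p : Ω → ℝ) (a : Ω) : Pr p {a} = p a := by
  classical
  simp [Pr, Set.indicator_apply]

theorem Pr_pos {Ω : Type*} [Fintype Ω] {p : Ω → ℝ} (hp : ∀ ω, 0 < p ω) {A : Set Ω}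
    (hA : A.Nonempty) : 0 < Pr p A := by
  obtain ⟨a, ha⟩ := hA
  refine Finset.sum_pos' (fun ω _ => Set.indicator_nonneg (fun ω _ => (hp ω).le) ω)
    ⟨a, Finset.mem_univ a, ?_⟩
  simpa [Set.indicator_of_mem ha] using hp a

/-- The pattern that agrees with `r` on the first `m` coordinates and is `true` afterwards. -/
def padTrue {K : ℕ} (r : Fin K → Bool) (m : ℕ) : Fin K → Bool :=
  fun j => if (j : ℕ) < m then r j else true

theorem padTrue_zero {K : ℕ} (r : Fin K → Bool) :
    padTrue r 0 = fun _ => true := by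
  funext j
  simp [padTrue]

theorem padTrue_self {K : ℕ} (r : Fin K → Bool) : padTrue r K = r := by
  funext j
  simp [padTrue]

theorem setOf_eq_inter_succOnePrecR {K : ℕ} (k : Fin K) (r : Fin K → Bool) :
    {s | s k = r k} ∩ succOnePrecR k r = {padTrue r (k + 1)} := by
  ext s
  simp only [Set.mem_inter_iff, Set.mem_ofPred_eq, succOnePrecR, Set.mem_singleton_iff,
    funext_iff, padTrue]
  constructor
  · rintro ⟨h, h_after, h_before⟩ j
    rcases lt_trichotomy j k with hj | rfl | hj
    · rw [h_before j hj, if_pos (by omega)]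
    · rw [h, if_pos (by omega)]
    · rw [h_after j hj, if_neg (by omega)]
  · intro h
    refine ⟨?_, fun j hj => ?_, fun j hj => ?_⟩
    · rw [h, if_pos (by omega)]
    · rw [h, if_neg (by omega)]
    · rw [h, if_pos (by omega)]

theorem setOf_true_inter_succOnePrecR {K : ℕ} (k : Fin K) (r : Fin K → Bool) :
    {s | s k = true} ∩ succOnePrecR k r = {padTrue r k} := by
  ext s
  simp only [Set.mem_inter_iff, Set.mem_ofPred_eq, succOnePrecR, Set.mem_singleton_iff,
    funext_iff, padTrue]
  constructor
  · rintro ⟨h, h_after, h_before⟩ j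
    rcases lt_trichotomy j k with hj | rfl | hj
    · rw [h_before j hj, if_pos (by omega)]
    · rw [h, if_neg (by omega)]
    · rw [h_after j hj, if_neg (by omega)]
  · intro h
    refine ⟨?_, fun j hj => ?_, fun j hj => ?_⟩
    · rw [h, if_neg (by omega)]
    · rw [h, if_neg (by omega)]
    · rw [h, if_pos (by omega)]

theorem succOnePrecR_nonempty {K : ℕ} (k : Fin K) (r : Fin K → Bool) :
    (succOnePrecR k r).Nonempty :=
  (Set.singleton_nonempty _).mono
    ((setOf_true_inter_succOnePrecR k r).symm.subset.trans Set.inter_subset_right)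

theorem minusOne_nonempty {K : ℕ} (k : Fin K) : (minusOne k).Nonempty :=
  ⟨fun _ => true, fun _ _ => rfl⟩

theorem minusOne_eq_succOnePrecR {K : ℕ} {k : Fin K} (hk : (k : ℕ) = 0) (r : Fin K → Bool) :
    minusOne k = succOnePrecR k r := by
  ext s
  refine ⟨fun h => ⟨fun j hj => h j hj.ne', fun j hj => by omega⟩, fun h j hj => h.1 j ?_⟩
  omega

theorem cPr_minusOne_pos {K : ℕ} {p : (Fin K → Bool) → ℝ} (hp : ∀ s, 0 < p s) (k : Fin K)
    (b : Bool) : 0 < cPr p {s | s k = b} (minusOne k) := by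
  refine div_pos (Pr_pos hp ⟨Function.update (fun _ => true) k b, by simp, fun j hj => ?_⟩)
    (Pr_pos hp (minusOne_nonempty k))
  simp [Function.update_of_ne hj]

theorem cPr_succOnePrecR_div {K : ℕ} {p : (Fin K → Bool) → ℝ} (hp : ∀ s, 0 < p s)
    (k : Fin K) (r : Fin K → Bool) :
    cPr p {s | s k = r k} (succOnePrecR k r) / cPr p {s | s k = true} (succOnePrecR k r)
      = p (padTrue r (k + 1)) / p (padTrue r k) := by
  rw [cPr, cPr, setOf_eq_inter_succOnePrecR, setOf_true_inter_succOnePrecR, Pr_singleton,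
    Pr_singleton, div_div_div_cancel_right₀ (Pr_pos hp (succOnePrecR_nonempty k r)).ne']

theorem cPr_mul_ORfactor {K : ℕ} {p : (Fin K → Bool) → ℝ} (hp : ∀ s, 0 < p s)
    (k : Fin K) (r : Fin K → Bool) :
    cPr p {s | s k = r k} (minusOne k) * (if 1 ≤ (k : ℕ) then ORfactor p k r else 1)
      = cPr p {s | s k = true} (minusOne k)
        * (p (padTrue r (k + 1)) / p (padTrue r k)) := by
  have h_eq := (cPr_minusOne_pos hp k (r k)).ne'
  have h_true := (cPr_minusOne_pos hp k true).ne'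
  rw [← cPr_succOnePrecR_div hp]
  split_ifs with hk
  · rw [ORfactor]
    field_simp
  · rw [← minusOne_eq_succOnePrecR (by omega) r]
    field_simp

/-- The unnormalized odds-ratio product telescopes to a constant multiple of `p`. -/
theorem prod_cPr_mul_prod_ORfactor {K : ℕ} {p : (Fin K → Bool) → ℝ} (hp : ∀ s, 0 < p s)
    (r : Fin K → Bool) :
    (∏ k : Fin K, cPr p {s | s k = r k} (minusOne k))
        * ∏ k ∈ Finset.univ.filter (fun k : Fin K => 1 ≤ (k : ℕ)), ORfactor p k r
      = (∏ k : Fin K, cPr p {s | s k = true} (minusOne k)) / p (fun _ => true) * p r := by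
  have h_telescope : ∏ k : Fin K, p (padTrue r (k + 1)) / p (padTrue r k)
      = p r / p (fun _ => true) := by
    rw [Fin.prod_univ_eq_prod_range
      (fun m => p (padTrue r (m + 1)) / p (padTrue r m)) K]
    have h (n : ℕ) : ∏ m ∈ Finset.range n, p (padTrue r (m + 1)) / p (padTrue r m)
        = p (padTrue r n) / p (padTrue r 0) := by
      induction n with
      | zero => simp [(hp _).ne']
      | succ n ih =>
        rw [Finset.prod_range_succ, ih, mul_comm, div_mul_div_cancel₀ (hp _).ne']
    rw [h, padTrue_self, padTrue_zero]
  rw [Finset.prod_filter, ← Finset.prod_mul_distrib,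
    Finset.prod_congr rfl fun k _ => cPr_mul_ORfactor hp k r, Finset.prod_mul_distrib, h_telescope]
  ring

/-- The odds-ratio parameterization of a strictly positive joint law of `K` binary
missingness indicators (Equation (6)):  `σ > 0` and
`p(r) = (1/σ) · ∏_k p(R_k = r_k | R_{−k}=1) · ∏_{k≥2} OR_k(r)`.
(Coordinates are 0-indexed, so "`2 ≤ k`" becomes `1 ≤ (k : ℕ)`.) -/
theorem stmt_4 {K : ℕ} (hK : 1 ≤ K)
    (p : (Fin K → Bool) → ℝ) (hp : ∀ s, 0 < p s) (hpsum : ∑ s, p s = 1) :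
    0 < (∑ r : Fin K → Bool,
        (∏ k : Fin K, cPr p {s | s k = r k} (minusOne k))
          * ∏ k ∈ Finset.univ.filter (fun k : Fin K => 1 ≤ (k : ℕ)), ORfactor p k r)
    ∧ ∀ r : Fin K → Bool,
        p r = (1 / (∑ r' : Fin K → Bool,
              (∏ k : Fin K, cPr p {s | s k = r' k} (minusOne k))
                * ∏ k ∈ Finset.univ.filter (fun k : Fin K => 1 ≤ (k : ℕ)), ORfactor p k r'))
            * (∏ k : Fin K, cPr p {s | s k = r k} (minusOne k))
            * ∏ k ∈ Finset.univ.filter (fun k : Fin K => 1 ≤ (k : ℕ)), ORfactor p k r := by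
  have h_const : 0 < (∏ k : Fin K, cPr p {s | s k = true} (minusOne k)) / p (fun _ => true) :=
    div_pos (Finset.prod_pos fun k _ => cPr_minusOne_pos hp k true) (hp _)
  simp_rw [mul_assoc, prod_cPr_mul_prod_ORfactor hp, ← Finset.mul_sum, hpsum, mul_one]
  refine ⟨h_const, fun r => ?_⟩
  rw [← mul_assoc, one_div_mul_cancel h_const.ne', one_mul]
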